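/- Let Ω ⊂ ℝⁿ be open, u ∈ L¹_loc(Ω), and X a smooth vector field on Ω. If ρ_ε is a family of rescaled smooth mollifiers, then (D_X u) * ρ_ε − X(u * ρ_ε) → 0 strongly in L¹_loc(Ω) as ε ↓ 0, where D_X u denotes the distributional derivative of u along X. -/

import Mathlib

open MeasureTheory Set Filter RealInnerProductSpace

/-- Euclidean divergence of a vector field on ℝⁿ. -/
noncomputable def euclDiv {n : ℕ} (a : EuclideanSpace ℝ (Fin n) → EuclideanSpace ℝ (Fin n))
    (x : EuclideanSpace ℝ (Fin n)) : ℝ :=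
  ∑ j, fderiv ℝ (fun y => a y j) x (EuclideanSpace.single j 1)

theorem tendsto_lintegral_enorm_comp_sub_sub {E : Type*} [NormedAddCommGroup E]
    [NormedSpace ℝ E] [FiniteDimensional ℝ E] [MeasurableSpace E] [BorelSpace E]
    {μ : Measure E} [μ.IsAddHaarMeasure] {v : E → ℝ} (hv : Integrable v μ) :
    Tendsto (fun h : E => ∫⁻ x, ‖v (x - h) - v x‖ₑ ∂μ) (nhds 0) (nhds 0) := by
  have hv1 : MemLp v 1 μ := memLp_one_iff_integrable.2 hv
  let g : C(E, C(E, E)) := (ContinuousMap.mk (fun p : E × E => p.2 - p.1) (by fun_prop)).curry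
  have hg : ∀ h, MeasurePreserving (g h) μ μ := fun h => measurePreserving_sub_right μ h
  have hcont : Continuous fun h => Lp.compMeasurePreserving (g h) (hg h) hv1.toLp :=
    continuous_const.compMeasurePreservingLp g.continuous hg ENNReal.one_ne_top
  have key : ∀ h, edist (Lp.compMeasurePreserving (g h) (hg h) hv1.toLp) hv1.toLp
      = ∫⁻ x, ‖v (x - h) - v x‖ₑ ∂μ := by
    intro h
    rw [Lp.toLp_compMeasurePreserving, Lp.edist_toLp_toLp, eLpNorm_one_eq_lintegral_enorm]
    rfl
  have hlim := (hcont.tendsto 0).edist (tendsto_const_nhds (x := hv1.toLp))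
  simp only [key] at hlim
  simpa using hlim

theorem lintegral_enorm_integral_mul_kernel_le {E : Type*} [NormedAddCommGroup E]
    [NormedSpace ℝ E] [FiniteDimensional ℝ E] [MeasurableSpace E] [BorelSpace E]
    {μ : Measure E} [μ.IsAddHaarMeasure] {v : E → ℝ} (hv : Integrable v μ)
    {K : Set E} (hK : MeasurableSet K) {k : E → E → ℝ} {M r : ℝ}
    (hk : ∀ x ∈ K, Integrable (k x) μ) (hk0 : ∀ x ∈ K, ∫ y, k x y ∂μ = 0)
    (hM : ∀ x ∈ K, ∀ y, |k x y| ≤ M)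
    (hr : ∀ x ∈ K, ∀ y, k x y ≠ 0 → ‖x - y‖ ≤ r) :
    ∫⁻ x in K, ‖∫ y, v y * k x y ∂μ‖ₑ ∂μ ≤
      ENNReal.ofReal M * ∫⁻ h in Metric.closedBall 0 r, ∫⁻ x, ‖v (x - h) - v x‖ₑ ∂μ ∂μ := by
  have hmeas : AEMeasurable (fun p : E × E => ‖v (p.1 - p.2) - v p.1‖ₑ)
      (μ.prod (μ.restrict (Metric.closedBall 0 r))) := by
    have h1 : AEStronglyMeasurable (fun p : E × E => v (p.1 - p.2) - v p.1) (μ.prod μ) :=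
      (hv.aestronglyMeasurable.comp_quasiMeasurePreserving
        (quasiMeasurePreserving_sub_of_right_invariant μ μ)).sub
        (hv.aestronglyMeasurable.comp_quasiMeasurePreserving
          Measure.quasiMeasurePreserving_fst)
    exact (h1.mono_ac (Measure.AbsolutelyContinuous.rfl.prod
      Measure.absolutelyContinuous_restrict)).enorm
  calc ∫⁻ x in K, ‖∫ y, v y * k x y ∂μ‖ₑ ∂μ
      ≤ ∫⁻ x in K, ENNReal.ofReal M *
          ∫⁻ h in Metric.closedBall 0 r, ‖v (x - h) - v x‖ₑ ∂μ ∂μ := by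
        refine setLIntegral_mono' hK fun x hx => ?_
        have hint : Integrable (fun y => v y * k x y) μ :=
          hv.mul_bdd (hk x hx).aestronglyMeasurable (.of_forall fun y => hM x hx y)
        have h1 : ∫ y, v y * k x y ∂μ = ∫ y, (v y - v x) * k x y ∂μ := by
          simp_rw [sub_mul]
          rw [integral_sub hint ((hk x hx).const_mul _), integral_const_mul, hk0 x hx]
          simp
        rw [h1]
        calc ‖∫ y, (v y - v x) * k x y ∂μ‖ₑ
            ≤ ∫⁻ y, ‖(v y - v x) * k x y‖ₑ ∂μ := enorm_integral_le_lintegral_enorm _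
          _ = ∫⁻ h, ‖(v (x - h) - v x) * k x (x - h)‖ₑ ∂μ :=
              (lintegral_sub_left_eq_self (fun y => ‖(v y - v x) * k x y‖ₑ) x).symm
          _ ≤ ∫⁻ h in Metric.closedBall 0 r, ENNReal.ofReal M * ‖v (x - h) - v x‖ₑ ∂μ := by
              rw [← lintegral_indicator Metric.isClosed_closedBall.measurableSet]
              refine lintegral_mono fun h => ?_
              by_cases hh : h ∈ Metric.closedBall (0 : E) r
              · rw [indicator_of_mem hh, enorm_mul, mul_comm]
                gcongr
                rw [Real.enorm_eq_ofReal_abs]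
                exact ENNReal.ofReal_le_ofReal (hM x hx _)
              · have : k x (x - h) = 0 := by
                  by_contra hne
                  exact hh (by simpa using hr x hx _ hne)
                simp [this]
          _ = _ := lintegral_const_mul' _ _ ENNReal.ofReal_ne_top
    _ ≤ ∫⁻ x, ENNReal.ofReal M *
          ∫⁻ h in Metric.closedBall 0 r, ‖v (x - h) - v x‖ₑ ∂μ ∂μ := setLIntegral_le_lintegral _ _
    _ = ENNReal.ofReal M *
          ∫⁻ h in Metric.closedBall 0 r, ∫⁻ x, ‖v (x - h) - v x‖ₑ ∂μ ∂μ := by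
        rw [lintegral_const_mul' _ _ ENNReal.ofReal_ne_top, lintegral_lintegral_swap hmeas]

theorem integral_fderiv_apply_add_mul_euclDiv {n : ℕ}
    {b : EuclideanSpace ℝ (Fin n) → EuclideanSpace ℝ (Fin n)} (hb : ContDiff ℝ 1 b)
    {ψ : EuclideanSpace ℝ (Fin n) → ℝ} (hψ : ContDiff ℝ 1 ψ) (hψc : HasCompactSupport ψ) :
    ∫ y, (fderiv ℝ ψ y (b y) + ψ y * euclDiv b y) = 0 := by
  have hbj : ∀ j, ContDiff ℝ 1 fun y => b y j := fun j => (contDiff_euclidean.1 hb) j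
  have hdψ : Continuous (fderiv ℝ ψ) := hψ.continuous_fderiv one_ne_zero
  have hdb : ∀ j, Continuous (fderiv ℝ fun y => b y j) :=
    fun j => (hbj j).continuous_fderiv one_ne_zero
  have i1 : ∀ j, Integrable fun y =>
      b y j * fderiv ℝ ψ y (EuclideanSpace.single j (1 : ℝ)) := fun j =>
    ((hbj j).continuous.mul (hdψ.clm_apply continuous_const)).integrable_of_hasCompactSupport
      (HasCompactSupport.mul_left (hψc.fderiv_apply ℝ _))
  have i2 : ∀ j, Integrable fun y =>
      fderiv ℝ (fun z => b z j) y (EuclideanSpace.single j (1 : ℝ)) * ψ y := fun j =>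
    (((hdb j).clm_apply continuous_const).mul hψ.continuous).integrable_of_hasCompactSupport
      (HasCompactSupport.mul_left hψc)
  have i3 : ∀ j, Integrable fun y => b y j * ψ y := fun j =>
    ((hbj j).continuous.mul hψ.continuous).integrable_of_hasCompactSupport
      (HasCompactSupport.mul_left hψc)
  have hsum : ∀ y, fderiv ℝ ψ y (b y) + ψ y * euclDiv b y =
      ∑ j, (b y j * fderiv ℝ ψ y (EuclideanSpace.single j (1 : ℝ)) +
        fderiv ℝ (fun z => b z j) y (EuclideanSpace.single j (1 : ℝ)) * ψ y) := by
    intro y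
    have hby : b y = ∑ j, b y j • EuclideanSpace.single j (1 : ℝ) := by
      simpa using ((EuclideanSpace.basisFun (Fin n) ℝ).sum_repr (b y)).symm
    rw [Finset.sum_add_distrib, euclDiv, Finset.mul_sum]
    congr 1
    · conv_lhs => rw [hby]
      simp
    · simp_rw [mul_comm]
  simp_rw [hsum]
  rw [integral_finsetSum _ fun j _ => by exact (i1 j).add (i2 j)]
  refine Finset.sum_eq_zero fun j _ => ?_
  rw [integral_add (i1 j) (i2 j), integral_mul_fderiv_eq_neg_fderiv_mul_of_integrable (i2 j) (i1 j)
    (i3 j) (fun x _ => (hbj j).differentiable one_ne_zero x)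
    (fun x _ => hψ.differentiable one_ne_zero x)]
  simp

theorem continuous_euclDiv {n : ℕ} {a : EuclideanSpace ℝ (Fin n) → EuclideanSpace ℝ (Fin n)}
    (ha : ContDiff ℝ 1 a) : Continuous (euclDiv a) :=
  continuous_finsetSum _ fun j _ =>
    (((contDiff_euclidean.1 ha) j).continuous_fderiv one_ne_zero).clm_apply continuous_const

/-- The kernel of the commutator between convolution with `φ` and the derivation along `a`. -/
noncomputable def commutatorKernel {n : ℕ}
    (a : EuclideanSpace ℝ (Fin n) → EuclideanSpace ℝ (Fin n))
    (φ : EuclideanSpace ℝ (Fin n) → ℝ) (x y : EuclideanSpace ℝ (Fin n)) : ℝ :=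
  fderiv ℝ φ (x - y) (a y - a x) - φ (x - y) * euclDiv a y

section commutatorKernel

variable {n : ℕ} {a : EuclideanSpace ℝ (Fin n) → EuclideanSpace ℝ (Fin n)}
  {φ : EuclideanSpace ℝ (Fin n) → ℝ}

theorem continuous_fderiv_sub_apply_sub (ha : ContDiff ℝ 1 a) (hφ : ContDiff ℝ 1 φ)
    (x : EuclideanSpace ℝ (Fin n)) : Continuous fun y => fderiv ℝ φ (x - y) (a y - a x) := by
  have hdφ : Continuous (fderiv ℝ φ) := hφ.continuous_fderiv one_ne_zero
  have hac : Continuous a := ha.continuous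
  fun_prop

theorem hasCompactSupport_fderiv_sub_apply_sub (hφc : HasCompactSupport φ)
    (x : EuclideanSpace ℝ (Fin n)) :
    HasCompactSupport fun y => fderiv ℝ φ (x - y) (a y - a x) := by
  refine ((hφc.fderiv ℝ).comp_homeomorph (Homeomorph.subLeft x)).mono fun y hy => ?_
  contrapose! hy
  simp only [Function.mem_support, not_not, Function.comp_apply, Homeomorph.subLeft_apply] at hy ⊢
  simp [hy]

theorem continuous_sub_mul_euclDiv (ha : ContDiff ℝ 1 a) (hφ : Continuous φ)
    (x : EuclideanSpace ℝ (Fin n)) : Continuous fun y => φ (x - y) * euclDiv a y := by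
  have hdiv := continuous_euclDiv ha
  fun_prop

theorem hasCompactSupport_sub_mul_euclDiv (hφc : HasCompactSupport φ)
    (x : EuclideanSpace ℝ (Fin n)) : HasCompactSupport fun y => φ (x - y) * euclDiv a y :=
  (hφc.comp_homeomorph (Homeomorph.subLeft x)).mul_right

theorem integrable_commutatorKernel (ha : ContDiff ℝ 1 a) (hφ : ContDiff ℝ 1 φ)
    (hφc : HasCompactSupport φ) (x : EuclideanSpace ℝ (Fin n)) :
    Integrable (commutatorKernel a φ x) :=
  ((continuous_fderiv_sub_apply_sub ha hφ x).integrable_of_hasCompactSupport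
    (hasCompactSupport_fderiv_sub_apply_sub hφc x)).sub
  ((continuous_sub_mul_euclDiv ha hφ.continuous x).integrable_of_hasCompactSupport
    (hasCompactSupport_sub_mul_euclDiv hφc x))

theorem integral_commutatorKernel (ha : ContDiff ℝ 1 a) (hφ : ContDiff ℝ 1 φ)
    (hφc : HasCompactSupport φ) (x : EuclideanSpace ℝ (Fin n)) :
    ∫ y, commutatorKernel a φ x y = 0 := by
  have h := integral_fderiv_apply_add_mul_euclDiv (b := fun y => a y - a x) (by fun_prop)
    (ψ := fun y => φ (x - y)) (by fun_prop) (hφc.comp_homeomorph (Homeomorph.subLeft x))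
  rw [← neg_zero, ← h, ← integral_neg]
  congr 1 with y
  have h1 : fderiv ℝ (fun y => φ (x - y)) y = -fderiv ℝ φ (x - y) := by
    have h3 : HasFDerivAt (fun y => φ (x - y)) _ y :=
      ((hφ.differentiable one_ne_zero (x - y)).hasFDerivAt).comp y
        ((hasFDerivAt_id y).const_sub x)
    rw [h3.fderiv]
    ext z
    simp
  have h2 : euclDiv (fun y => a y - a x) y = euclDiv a y := by
    simp only [euclDiv, PiLp.sub_apply, fderiv_sub_const]
  rw [h1, h2, commutatorKernel]
  simp
  ring

theorem setIntegral_sub_setIntegral_eq_integral_commutatorKernel (ha : ContDiff ℝ 1 a)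
    (hφ : ContDiff ℝ 1 φ) (hφc : HasCompactSupport φ) {Ω K' : Set (EuclideanSpace ℝ (Fin n))}
    (hΩ : MeasurableSet Ω) (hK' : MeasurableSet K') (hK'Ω : K' ⊆ Ω)
    {u : EuclideanSpace ℝ (Fin n) → ℝ} (hu : IntegrableOn u K') {x : EuclideanSpace ℝ (Fin n)}
    (hx : ∀ y, x - y ∈ tsupport φ → y ∈ K') :
    (∫ y in Ω, u y * ⟪a y - a x, gradient φ (x - y)⟫) - ∫ y in Ω, u y * φ (x - y) * euclDiv a y =
      ∫ y, K'.indicator u y * commutatorKernel a φ x y := by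
  have hextend : ∀ G : EuclideanSpace ℝ (Fin n) → ℝ, (∀ y, y ∉ K' → G y = 0) →
      ∫ y in Ω, u y * G y = ∫ y, K'.indicator u y * G y := by
    intro G hG
    rw [← integral_indicator hΩ]
    congr 1 with y
    by_cases hy : y ∈ K'
    · rw [indicator_of_mem (hK'Ω hy), indicator_of_mem hy]
    · rw [indicator_of_notMem hy, zero_mul, indicator_apply_eq_zero]
      intro _
      rw [hG y hy, mul_zero]
  have hv : Integrable (K'.indicator u) := (integrable_indicator_iff hK').2 hu
  have hint : ∀ {G : EuclideanSpace ℝ (Fin n) → ℝ}, Continuous G → HasCompactSupport G →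
      Integrable fun y => K'.indicator u y * G y := by
    intro G hG hGc
    obtain ⟨C, hC⟩ := hGc.exists_bound_of_continuous hG
    exact hv.mul_bdd hG.aestronglyMeasurable (.of_forall hC)
  simp_rw [mul_assoc, real_inner_comm (gradient φ _), inner_gradient_left]
  rw [hextend _ fun y hy => ?_, hextend _ fun y hy => ?_, ← integral_sub
    (hint (continuous_fderiv_sub_apply_sub ha hφ x) (hasCompactSupport_fderiv_sub_apply_sub hφc x))
    (hint (continuous_sub_mul_euclDiv ha hφ.continuous x)
      (hasCompactSupport_sub_mul_euclDiv hφc x))]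
  · simp_rw [commutatorKernel, mul_sub]
  · rw [image_eq_zero_of_notMem_tsupport fun h => hy (hx y h), zero_mul]
  · rw [image_eq_zero_of_notMem_tsupport fun h => hy (hx y (tsupport_fderiv_subset ℝ h)),
      zero_apply]

theorem abs_commutatorKernel_le {S : Set (EuclideanSpace ℝ (Fin n))} (hS : Convex ℝ S)
    (ha : Differentiable ℝ a) {L D A B r : ℝ}
    (hL : ∀ x ∈ S, ‖fderiv ℝ a x‖ ≤ L) (hD : ∀ x ∈ S, ‖euclDiv a x‖ ≤ D)
    (hφA : ∀ z, ‖φ z‖ ≤ A) (hφB : ∀ z, ‖fderiv ℝ φ z‖ ≤ B) {x y : EuclideanSpace ℝ (Fin n)}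
    (hx : x ∈ S) (hy : y ∈ S) (hxy : ‖x - y‖ ≤ r) :
    |commutatorKernel a φ x y| ≤ B * (L * r) + A * D := by
  have hL0 : 0 ≤ L := (norm_nonneg _).trans (hL x hx)
  have hA0 : 0 ≤ A := (norm_nonneg _).trans (hφA 0)
  have h1 : ‖a y - a x‖ ≤ L * r := by
    refine (hS.norm_image_sub_le_of_norm_fderiv_le (fun z _ => ha z) hL hx hy).trans ?_
    rw [norm_sub_rev]
    gcongr
  calc |commutatorKernel a φ x y|
      ≤ ‖fderiv ℝ φ (x - y) (a y - a x)‖ + ‖φ (x - y) * euclDiv a y‖ := by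
        rw [← Real.norm_eq_abs]
        exact norm_sub_le _ _
    _ ≤ B * (L * r) + A * D := by
        rw [norm_mul]
        gcongr
        · exact (fderiv ℝ φ (x - y)).le_of_opNorm_le_of_le (hφB _) h1
        · exact hφA _
        · exact hD y hy

theorem commutatorKernel_eq_zero {x y : EuclideanSpace ℝ (Fin n)} (h : x - y ∉ tsupport φ) :
    commutatorKernel a φ x y = 0 := by
  rw [commutatorKernel, image_eq_zero_of_notMem_tsupport h,
    image_eq_zero_of_notMem_tsupport fun h' => h (tsupport_fderiv_subset ℝ h')]
  simp

end commutatorKernel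

/-- commutator lemma: for `u ∈ L¹_loc(Ω)`, `X = Σ aⱼ∂ⱼ` smooth and rescaled
mollifiers `ρ_ε`, the commutator `(D_X u) * ρ_ε − X(u * ρ_ε)` tends to `0` in `L¹_loc(Ω)`
as `ε ↓ 0`.  Here `(D_X u)*ρ_ε(x) − X(u*ρ_ε)(x)` is written out explicitly as
`∫_Ω u(y) ⟪a(y) − a(x), (∇ρ_ε)(x−y)⟫ dy − ∫_Ω u(y) ρ_ε(x−y) div a(y) dy`. -/
theorem stmt1 {n : ℕ} (Ω : Set (EuclideanSpace ℝ (Fin n))) (hΩ : IsOpen Ω)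
    (u : EuclideanSpace ℝ (Fin n) → ℝ) (hu : LocallyIntegrableOn u Ω)
    (a : EuclideanSpace ℝ (Fin n) → EuclideanSpace ℝ (Fin n)) (ha : ContDiff ℝ (⊤ : ℕ∞) a)
    (ρ : EuclideanSpace ℝ (Fin n) → ℝ) (hρ : ContDiff ℝ (⊤ : ℕ∞) ρ)
    (hρc : HasCompactSupport ρ) (hρeven : ∀ z, ρ (-z) = ρ z)
    (hρint : ∫ z, ρ z = 1) :
    ∀ K : Set (EuclideanSpace ℝ (Fin n)), IsCompact K → K ⊆ Ω →
      Tendsto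
        (fun ε : ℝ => ∫ x in K,
          |(∫ y in Ω, u y *
              ⟪a y - a x, gradient (fun z => ε⁻¹ ^ n * ρ (ε⁻¹ • z)) (x - y)⟫) -
            ∫ y in Ω, u y * (ε⁻¹ ^ n * ρ (ε⁻¹ • (x - y))) * euclDiv a y|)
        (nhdsWithin 0 (Set.Ioi 0)) (nhds 0) := by
  intro K hK hKΩ
  have ha1 : ContDiff ℝ 1 a := ha.of_le (by exact_mod_cast le_top)
  have hρ1 : ContDiff ℝ 1 ρ := hρ.of_le (by exact_mod_cast le_top)
  obtain ⟨δ, hδ, hδΩ⟩ := hK.exists_cthickening_subset_open hΩ hKΩ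
  set K' := Metric.cthickening δ K
  have hK'c : IsCompact K' := hK.cthickening
  have huK' : IntegrableOn u K' := hu.integrableOn_compact_subset hδΩ hK'c
  have hv : Integrable (K'.indicator u) := (integrable_indicator_iff hK'c.measurableSet).2 huK'
  obtain ⟨m, hm⟩ := hK'c.isBounded.subset_closedBall (0 : EuclideanSpace ℝ (Fin n))
  have hball : IsCompact (Metric.closedBall (0 : EuclideanSpace ℝ (Fin n)) m) :=
    isCompact_closedBall 0 m
  obtain ⟨L, hL⟩ := hball.exists_bound_of_continuousOn
    (ha1.continuous_fderiv one_ne_zero).continuousOn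
  obtain ⟨D, hD⟩ := hball.exists_bound_of_continuousOn
    (continuous_euclDiv ha1).continuousOn
  obtain ⟨A, hA⟩ := hρc.exists_bound_of_continuous hρ1.continuous
  obtain ⟨B, hB⟩ := (hρc.fderiv ℝ).exists_bound_of_continuous (hρ1.continuous_fderiv one_ne_zero)
  have hA0 : 0 ≤ A := (norm_nonneg _).trans (hA 0)
  have hB0 : 0 ≤ B := (norm_nonneg _).trans (hB 0)
  obtain ⟨R, hR0, hR⟩ := hρc.isCompact.isBounded.subset_closedBall_lt 0 0
  set C := B * (L * R) + A * D with hC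
  set ω : EuclideanSpace ℝ (Fin n) → ENNReal :=
    fun h => ∫⁻ x, ‖K'.indicator u (x - h) - K'.indicator u x‖ₑ
  rw [tendsto_iff_edist_tendsto_0]
  simp_rw [edist_zero_right]
  rw [ENNReal.tendsto_nhds_zero]
  intro e he
  obtain ⟨η, hη0, hη⟩ := ENNReal.exists_nnreal_pos_mul_lt
    (a := ENNReal.ofReal C * volume (Metric.closedBall (0 : EuclideanSpace ℝ (Fin n)) R)) (b := e)
    (ENNReal.mul_ne_top ENNReal.ofReal_ne_top measure_closedBall_lt_top.ne) he.ne'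
  obtain ⟨s, hs0, hs⟩ := Metric.nhds_basis_closedBall.eventually_iff.1
    (ENNReal.tendsto_nhds_zero.1 (tendsto_lintegral_enorm_comp_sub_sub hv) η
      (ENNReal.coe_pos.2 hη0))
  have hsmall : ∀ᶠ ε : ℝ in nhdsWithin 0 (Ioi 0), ε * R < min δ s :=
    (((continuous_id.mul continuous_const).tendsto' (0 : ℝ) 0 (by simp)).mono_left
      nhdsWithin_le_nhds).eventually_lt_const (lt_min hδ hs0)
  filter_upwards [hsmall, self_mem_nhdsWithin] with ε hεsmall hε
  have hε0 : 0 < ε := hε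
  have hεδ : ε * R ≤ δ := hεsmall.le.trans (min_le_left _ _)
  have hεs : ε * R ≤ s := hεsmall.le.trans (min_le_right _ _)
  set φ : EuclideanSpace ℝ (Fin n) → ℝ := fun z => ε⁻¹ ^ n * ρ (ε⁻¹ • z) with hφdef
  have hφ1 : ContDiff ℝ 1 φ := by fun_prop
  have hφs : ∀ z ∈ tsupport φ, ‖z‖ ≤ ε * R := by
    suffices tsupport φ ⊆ Metric.closedBall 0 (ε * R) from fun z hz => by simpa using this hz
    refine closure_minimal (fun z hz => ?_) Metric.isClosed_closedBall
    have h1 : ε⁻¹ • z ∈ Metric.closedBall 0 R :=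
      hR (subset_tsupport _ fun h0 => hz (by simp [hφdef, h0]))
    rw [mem_closedBall_zero_iff, norm_smul, norm_inv, Real.norm_of_nonneg hε0.le,
      inv_mul_le_iff₀ hε0] at h1
    simpa using h1
  have hφc : HasCompactSupport φ := HasCompactSupport.intro
    (isCompact_closedBall (0 : EuclideanSpace ℝ (Fin n)) (ε * R)) fun z hz =>
      image_eq_zero_of_notMem_tsupport fun h => hz (by simpa using hφs z h)
  have hφA : ∀ z, ‖φ z‖ ≤ ε⁻¹ ^ n * A := by
    intro z
    rw [hφdef, norm_mul, Real.norm_of_nonneg (by positivity)]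
    gcongr
    exact hA _
  have hφB : ∀ z, ‖fderiv ℝ φ z‖ ≤ ε⁻¹ ^ n * (ε⁻¹ * B) := by
    intro z
    have : DifferentiableAt ℝ (fun z => ρ (ε⁻¹ • z)) z :=
      (hρ1.differentiable one_ne_zero).comp (by fun_prop : Differentiable ℝ fun z => ε⁻¹ • z) z
    rw [hφdef, fderiv_const_mul this, fderiv_comp_smul, norm_smul, norm_smul,
      Real.norm_of_nonneg (by positivity), Real.norm_of_nonneg (by positivity)]
    gcongr
    exact hB _
  have hclose : ∀ x ∈ K, ∀ y, x - y ∈ tsupport φ → y ∈ K' := fun x hx y hy =>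
    Metric.mem_cthickening_of_dist_le y x δ K hx (by
      rw [dist_comm, dist_eq_norm]
      exact (hφs _ hy).trans hεδ)
  have hsupp : ∀ x y, commutatorKernel a φ x y ≠ 0 → x - y ∈ tsupport φ := fun x y h => by
    by_contra h'
    exact h (commutatorKernel_eq_zero h')
  have hbound : ∀ x ∈ K, ∀ y, |commutatorKernel a φ x y| ≤ ε⁻¹ ^ n * C := by
    intro x hx y
    have hxS := hm (Metric.self_subset_cthickening K hx)
    have hC0 : 0 ≤ C := by
      have := (norm_nonneg _).trans (hL x hxS)
      have := (norm_nonneg _).trans (hD x hxS)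
      positivity
    by_cases hxy : commutatorKernel a φ x y = 0
    · rw [hxy, abs_zero]
      positivity
    · have hxy' := hsupp x y hxy
      refine (abs_commutatorKernel_le (convex_closedBall 0 m) (ha1.differentiable one_ne_zero)
        hL hD hφA hφB hxS (hm (hclose x hx y hxy'))
        (hφs _ hxy')).trans_eq ?_
      rw [hC]
      field_simp
  calc _ ≤ ∫⁻ x in K, ‖∫ y, K'.indicator u y * commutatorKernel a φ x y‖ₑ := by
        refine (enorm_integral_le_lintegral_enorm _).trans
          (setLIntegral_mono' hK.measurableSet fun x hx => ?_)
        rw [Real.enorm_eq_ofReal_abs, abs_abs, ← Real.enorm_eq_ofReal_abs,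
          ← setIntegral_sub_setIntegral_eq_integral_commutatorKernel ha1 hφ1 hφc
            hΩ.measurableSet hK'c.measurableSet hδΩ huK' (hclose x hx)]
    _ ≤ ENNReal.ofReal (ε⁻¹ ^ n * C) * ∫⁻ h in Metric.closedBall 0 (ε * R), ω h :=
        lintegral_enorm_integral_mul_kernel_le hv hK.measurableSet
          (fun x _ => integrable_commutatorKernel ha1 hφ1 hφc x)
          (fun x _ => integral_commutatorKernel ha1 hφ1 hφc x) hbound
          (fun x _ y hxy => hφs _ (hsupp x y hxy))
    _ ≤ ENNReal.ofReal (ε⁻¹ ^ n * C) * ∫⁻ h in Metric.closedBall 0 (ε * R),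
          (η : ENNReal) ∂(volume : Measure (EuclideanSpace ℝ (Fin n))) := by
        refine mul_le_mul_right (?_ : _ ≤ _) _
        exact setLIntegral_mono' Metric.isClosed_closedBall.measurableSet fun h hh =>
          hs (Metric.closedBall_subset_closedBall hεs hh)
    _ = η * (ENNReal.ofReal C *
          volume (Metric.closedBall (0 : EuclideanSpace ℝ (Fin n)) R)) := by
        rw [setLIntegral_const, Measure.addHaar_closedBall_mul_of_pos _ _ hε0,
          finrank_euclideanSpace_fin, ENNReal.ofReal_mul (by positivity)]
        have : ENNReal.ofReal (ε⁻¹ ^ n) * ENNReal.ofReal (ε ^ n) = 1 := by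
          rw [← ENNReal.ofReal_mul (by positivity), ← mul_pow, inv_mul_cancel₀ hε0.ne']
          simp
        calc _ = (ENNReal.ofReal (ε⁻¹ ^ n) * ENNReal.ofReal (ε ^ n)) *
              (η * (ENNReal.ofReal C *
                volume (Metric.closedBall (0 : EuclideanSpace ℝ (Fin n)) R))) := by ring
          _ = _ := by rw [this, one_mul]
    _ ≤ e := hη.le
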